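/- Let h : ℕ → ℕ be a computable function such that n ↦ h(n) − n is nondecreasing and Σ_n 2^{n−h(n)} = ∞. Then there exist two left-c.e. reals α, β ∈ (0,1) such that for every left-c.e. real γ ∈ [0,1] and every constant c, it is not the case that both α and β are computable from γ with oracle-use n ↦ h(n) + c. -/

import Mathlib

open scoped Classical

/-- A set of binary strings is prefix-free if no element is a proper prefix of another. -/
def PrefixFreeSet (D : Set (List Bool)) : Prop :=
  ∀ σ ∈ D, ∀ τ ∈ D, σ <+: τ → σ = τ

/-- A prefix-free machine: a partial computable function on binary strings
whose domain is prefix-free. -/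
structure PFMachine where
  f : List Bool →. List Bool
  partrec : Partrec f
  prefixFree : PrefixFreeSet {σ | (f σ).Dom}

/-- The halting probability `Ω_M = Σ_{σ ∈ dom M} 2^{-|σ|}` of a prefix-free machine. -/
noncomputable def omegaOf (M : PFMachine) : ℝ :=
  ∑' σ : {σ : List Bool // (M.f σ).Dom}, (2 : ℝ) ^ (-(σ.1.length : ℤ))

/-- A computable nondecreasing sequence of rationals converging to `x`. -/
def LeftCEApprox (q : ℕ → ℚ) (x : ℝ) : Prop :=
  Computable q ∧ Monotone q ∧
    Filter.Tendsto (fun n => (q n : ℝ)) Filter.atTop (nhds x)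

/-- A real is left-c.e. if some computable nondecreasing rational sequence converges to it. -/
def LeftCE (x : ℝ) : Prop := ∃ q : ℕ → ℚ, LeftCEApprox q x

/-- A real is right-c.e. if its negative is left-c.e. -/
def RightCE (x : ℝ) : Prop := LeftCE (-x)

/-- Martin-Löf randomness of a real, via computable sequences of open rational intervals. -/
def MLRandom (x : ℝ) : Prop :=
  ∀ I : ℕ → ℕ → ℚ × ℚ, Computable₂ I →
    (∀ n : ℕ, MeasureTheory.volume
        (⋃ k : ℕ, Set.Ioo (((I n k).1 : ℝ)) (((I n k).2 : ℝ))) ≤ 2 ^ (-(n : ℤ))) →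
    x ∉ ⋂ n : ℕ, ⋃ k : ℕ, Set.Ioo (((I n k).1 : ℝ)) (((I n k).2 : ℝ))

/-- A universal prefix-free machine: it simulates every prefix-free machine
via a fixed prefix. -/
def UniversalPF (U : PFMachine) : Prop :=
  ∀ M : PFMachine, ∃ ρ : List Bool, ∀ σ : List Bool, U.f (ρ ++ σ) = M.f σ

/-- The `i`-th binary digit of a real (of its expansion not ending in all 1s). -/
noncomputable def rdigit (x : ℝ) (i : ℕ) : Bool := decide (⌊x * 2 ^ (i + 1)⌋ % 2 = 1)

/-- The first `n` binary digits of a real. -/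
noncomputable def bits (x : ℝ) (n : ℕ) : List Bool := (List.range n).map (rdigit x)

/-- Prefix-free Kolmogorov complexity of `σ` with respect to machine `M`,
with value `⊤` if `σ` is not in the range. -/
noncomputable def Kf (M : PFMachine) (σ : List Bool) : ℕ∞ :=
  ⨅ p : {p : List Bool // σ ∈ M.f p}, (p.1.length : ℕ∞)

/-- An optimal prefix-free machine: minimizes `K` up to additive constants. -/
def OptimalPF (V : PFMachine) : Prop :=
  ∀ M : PFMachine, ∃ c : ℕ, ∀ σ : List Bool, Kf V σ ≤ Kf M σ + c

/-- Solovay reducibility for left-c.e. reals. -/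
def SolovayRed (α β : ℝ) : Prop :=
  ∃ c : ℚ, ∃ f : ℚ →. ℚ, Partrec f ∧
    ∀ q : ℚ, (q : ℝ) < β →
      ∃ r ∈ f q, (r : ℝ) < α ∧ α - (r : ℝ) < (c : ℝ) * (β - (q : ℝ))

/-- `X` is computable from `Y` with oracle-use `h`. -/
def ComputableFromWithUse (X Y : ℝ) (h : ℕ → ℕ) : Prop :=
  ∃ Φ : List Bool →. List Bool, Partrec Φ ∧
    ∀ n : ℕ, Φ (bits Y (h n)) = Part.some (bits X n)

attribute [fun_prop] Computable

section ComputableToolkit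

variable {α β σ : Type*} [Primcodable α] [Primcodable β] [Primcodable σ]

@[fun_prop]
theorem Computable.fun_id : Computable (fun x : α => x) := Computable.id

@[fun_prop]
theorem Computable.fun_const (s : σ) : Computable (fun _ : α => s) := Computable.const s

@[fun_prop]
theorem Computable.fun_comp {f : β → σ} {g : α → β} (hf : Computable f) (hg : Computable g) :
    Computable (fun x => f (g x)) := hf.comp hg

@[fun_prop]
theorem Computable.fun_pair {f : α → β} {g : α → σ} (hf : Computable f) (hg : Computable g) :
    Computable (fun x => (f x, g x)) := hf.pair hg

@[fun_prop]
theorem Computable.fun_fst {f : α → β × σ} (hf : Computable f) :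
    Computable (fun x => (f x).1) := Computable.fst.comp hf

@[fun_prop]
theorem Computable.fun_snd {f : α → β × σ} (hf : Computable f) :
    Computable (fun x => (f x).2) := Computable.snd.comp hf

@[fun_prop]
theorem Computable.nat_add {f g : α → ℕ} (hf : Computable f) (hg : Computable g) :
    Computable (fun x => f x + g x) := Primrec.nat_add.to_comp.comp hf hg

@[fun_prop]
theorem Computable.nat_sub {f g : α → ℕ} (hf : Computable f) (hg : Computable g) :
    Computable (fun x => f x - g x) := Primrec.nat_sub.to_comp.comp hf hg

@[fun_prop]
theorem Computable.nat_mul {f g : α → ℕ} (hf : Computable f) (hg : Computable g) :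
    Computable (fun x => f x * g x) := Primrec.nat_mul.to_comp.comp hf hg

@[fun_prop]
theorem Computable.nat_div {f g : α → ℕ} (hf : Computable f) (hg : Computable g) :
    Computable (fun x => f x / g x) := Primrec.nat_div.to_comp.comp hf hg

@[fun_prop]
theorem Computable.nat_mod {f g : α → ℕ} (hf : Computable f) (hg : Computable g) :
    Computable (fun x => f x % g x) := Primrec.nat_mod.to_comp.comp hf hg

@[fun_prop]
theorem Computable.nat_pow {f g : α → ℕ} (hf : Computable f) (hg : Computable g) :
    Computable (fun x => f x ^ g x) :=
  (Primrec₂.unpaired'.1 Nat.Primrec.pow).to_comp.comp hf hg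

@[fun_prop]
theorem Computable.nat_unpair {f : α → ℕ} (hf : Computable f) :
    Computable (fun x => (f x).unpair) := Computable.unpair.comp hf

@[fun_prop]
theorem Computable.nat_pair {f g : α → ℕ} (hf : Computable f) (hg : Computable g) :
    Computable (fun x => Nat.pair (f x) (g x)) := Primrec₂.natPair.to_comp.comp hf hg

@[fun_prop]
theorem Computable.decide_le {f g : α → ℕ} (hf : Computable f) (hg : Computable g) :
    Computable (fun x => decide (f x ≤ g x)) := Primrec.nat_le.decide.to_comp.comp hf hg

@[fun_prop]
theorem Computable.decide_lt {f g : α → ℕ} (hf : Computable f) (hg : Computable g) :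
    Computable (fun x => decide (f x < g x)) := Primrec.nat_lt.decide.to_comp.comp hf hg

@[fun_prop]
theorem Computable.decide_eq {f g : α → ℕ} (hf : Computable f) (hg : Computable g) :
    Computable (fun x => decide (f x = g x)) := Primrec.eq.decide.to_comp.comp hf hg

@[fun_prop]
theorem Computable.bool_and {f g : α → Bool} (hf : Computable f) (hg : Computable g) :
    Computable (fun x => f x && g x) := Primrec.and.to_comp.comp hf hg

@[fun_prop]
theorem Computable.bool_toNat {f : α → Bool} (hf : Computable f) :
    Computable (fun x => (f x).toNat) := (Primrec.dom_bool Bool.toNat).to_comp.comp hf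

@[fun_prop]
theorem Computable.fun_encode {f : α → σ} (hf : Computable f) :
    Computable (fun x => Encodable.encode (f x)) := Computable.encode.comp hf

@[fun_prop]
theorem Computable.fun_ofNat {δ : Type*} [Denumerable δ] {f : α → ℕ} (hf : Computable f) :
    Computable (fun x => Denumerable.ofNat δ (f x)) := (Computable.ofNat δ).comp hf

@[fun_prop]
theorem Computable.fun_cond {c : α → Bool} {f g : α → σ} (hc : Computable c) (hf : Computable f)
    (hg : Computable g) : Computable (fun x => bif c x then f x else g x) :=
  Computable.cond hc hf hg

@[fun_prop]
theorem Computable.option_isSome {f : α → Option σ} (hf : Computable f) :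
    Computable (fun x => (f x).isSome) := Primrec.option_isSome.to_comp.comp hf

@[fun_prop]
theorem Computable.fun_option_getD {f : α → Option σ} {g : α → σ} (hf : Computable f)
    (hg : Computable g) : Computable (fun x => (f x).getD (g x)) :=
  Computable.option_getD hf hg

@[fun_prop]
theorem Computable.evaln {k : α → ℕ} {c : α → Nat.Partrec.Code} {n : α → ℕ} (hk : Computable k)
    (hc : Computable c) (hn : Computable n) :
    Computable (fun x => Nat.Partrec.Code.evaln (k x) (c x) (n x)) :=
  Nat.Partrec.Code.primrec_evaln.to_comp.comp ((hk.pair hc).pair hn)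

@[fun_prop]
theorem Computable.fun_nat_rec {f : α → ℕ} {g : α → σ} {h : α → ℕ → σ → σ} (hf : Computable f)
    (hg : Computable g) (hh : Computable fun p : α × ℕ × σ => h p.1 p.2.1 p.2.2) :
    Computable fun a => (Nat.rec (g a) (h a) (f a) : σ) :=
  Computable.nat_rec (h := fun a p => h a p.1 p.2) hf hg hh

@[fun_prop]
theorem Computable.sum_range {f : α → ℕ} {g : α → ℕ → ℕ} (hf : Computable f)
    (hg : Computable fun p : α × ℕ => g p.1 p.2) :
    Computable fun a => ∑ i ∈ Finset.range (f a), g a i := by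
  have key : Computable fun a => (Nat.rec 0 (fun n s => s + g a n) (f a) : ℕ) := by
    refine Computable.fun_nat_rec (h := fun a n s => s + g a n) hf (by fun_prop) ?_
    fun_prop
  refine key.of_eq fun a => ?_
  induction f a with
  | zero => rfl
  | succ n ih => rw [Finset.sum_range_succ, ← ih]

theorem Computable.list_map_range {f : α → ℕ} {g : α → ℕ → σ} (hf : Computable f)
    (hg : Computable fun p : α × ℕ => g p.1 p.2) :
    Computable fun a => (List.range (f a)).map (g a) := by
  have key : Computable fun a => (Nat.rec [] (fun n l => l ++ [g a n]) (f a) : List σ) := by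
    refine Computable.fun_nat_rec (h := fun a n l => l ++ [g a n]) hf (by fun_prop) ?_
    exact Computable.list_concat.comp (by fun_prop) (by fun_prop)
  refine key.of_eq fun a => ?_
  induction f a with
  | zero => rfl
  | succ n ih => simp [List.range_succ, ← ih]

theorem Computable.nat_find {p : α → ℕ → Bool} (hp : Computable fun x : α × ℕ => p x.1 x.2)
    (hex : ∀ a, ∃ n, p a n = true) : Computable fun a => Nat.find (hex a) := by
  have hr : Partrec fun a => Nat.rfind (fun n => Part.some (p a n)) :=
    Partrec.rfind (p := fun a n => Part.some (p a n)) hp.partrec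
  refine hr.of_eq_tot fun a => ?_
  refine Nat.mem_rfind.2 ⟨by simpa using Nat.find_spec (hex a), fun {m} hm => ?_⟩
  simpa using Nat.find_min (hex a) hm

end ComputableToolkit

section RationalCoding

open Encodable

/-- The code of a rational as a pair consisting of the codes of its numerator and denominator. -/
def ratCode (q : ℚ) : ℕ := Nat.pair (encode q.num) q.den

theorem encode_int_ofNat (z : ℕ) : encode (z : ℤ) = 2 * z := rfl

theorem encode_int_negSucc (z : ℕ) : encode (Int.negSucc z) = 2 * z + 1 := rfl

theorem mem_range_ratCode_iff (k : ℕ) :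
    k ∈ Set.range ratCode ↔ 0 < k.unpair.2 ∧ Nat.Coprime ((k.unpair.1 + 1) / 2) k.unpair.2 := by
  have natAbs_eq : ∀ z : ℤ, (encode z + 1) / 2 = z.natAbs := by
    rintro (z | z)
    · rw [Int.ofNat_eq_natCast, encode_int_ofNat]; simp; omega
    · rw [encode_int_negSucc]; simp; omega
  constructor
  · rintro ⟨q, rfl⟩
    simp only [ratCode, Nat.unpair_pair, natAbs_eq]
    exact ⟨q.pos, q.reduced⟩
  · rintro ⟨h1, h2⟩
    have henc : encode (Denumerable.ofNat ℤ k.unpair.1) = k.unpair.1 := Denumerable.encode_ofNat _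
    rw [← henc, natAbs_eq] at h2
    exact ⟨⟨_, _, h1.ne', h2⟩, by simp only [ratCode, henc, Nat.pair_unpair]⟩

theorem coprime_iff_sum_eq_zero {m d : ℕ} (hd : 0 < d) :
    Nat.Coprime m d ↔ ∑ k ∈ Finset.range (d + 1),
      (decide (2 ≤ k) && decide (m % k = 0) && decide (d % k = 0)).toNat = 0 := by
  rw [Finset.sum_eq_zero_iff]
  constructor
  · intro h k _
    by_contra hk
    simp only [Bool.toNat_eq_zero, Bool.not_eq_false, Bool.and_eq_true, decide_eq_true_eq] at hk
    have := Nat.dvd_gcd (Nat.dvd_of_mod_eq_zero hk.1.2) (Nat.dvd_of_mod_eq_zero hk.2)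
    rw [h.gcd_eq_one, Nat.dvd_one] at this
    omega
  · intro h
    have h1 := h (Nat.gcd m d)
      (Finset.mem_range.2 (Nat.lt_succ_of_le (Nat.le_of_dvd hd (Nat.gcd_dvd_right m d))))
    have h2 : 0 < Nat.gcd m d := Nat.gcd_pos_of_pos_right m hd
    simp only [Bool.toNat_eq_zero, Bool.and_eq_false_iff, decide_eq_false_iff_not,
      Nat.mod_eq_zero_of_dvd (Nat.gcd_dvd_left m d),
      Nat.mod_eq_zero_of_dvd (Nat.gcd_dvd_right m d)] at h1
    simp at h1
    rw [Nat.coprime_iff_gcd_eq_one]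
    omega

/-- Decides membership in the range of `ratCode`. -/
def isRatCode (k : ℕ) : Bool :=
  decide (0 < k.unpair.2) && decide (∑ i ∈ Finset.range (k.unpair.2 + 1),
    (decide (2 ≤ i) && decide ((k.unpair.1 + 1) / 2 % i = 0) &&
      decide (k.unpair.2 % i = 0)).toNat = 0)

theorem isRatCode_iff (k : ℕ) : isRatCode k = true ↔ k ∈ Set.range ratCode := by
  rw [mem_range_ratCode_iff, isRatCode, Bool.and_eq_true, decide_eq_true_eq, decide_eq_true_eq]
  refine and_congr_right fun h => (coprime_iff_sum_eq_zero h).symm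

theorem computable_isRatCode : Computable isRatCode := by
  unfold isRatCode
  fun_prop

theorem exists_isRatCode_ge (m : ℕ) : ∃ k, (decide (m ≤ k) && isRatCode k) = true := by
  refine ⟨ratCode m, ?_⟩
  rw [Bool.and_eq_true, isRatCode_iff, decide_eq_true_eq]
  refine ⟨?_, Set.mem_range_self _⟩
  have h : m ≤ encode ((m : ℤ)) := by rw [encode_int_ofNat]; omega
  exact h.trans (Nat.left_le_pair _ _)

/-- The increasing enumeration of the range of `ratCode`. -/
def nthRatCode (n : ℕ) : ℕ :=
  Nat.rec (Nat.find (exists_isRatCode_ge 0)) (fun _ k => Nat.find (exists_isRatCode_ge (k + 1))) n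

theorem computable_nthRatCode : Computable nthRatCode := by
  have hfind : Computable fun m => Nat.find (exists_isRatCode_ge m) := by
    refine Computable.nat_find (p := fun m k => decide (m ≤ k) && isRatCode k) ?_ _
    have := computable_isRatCode
    fun_prop
  unfold nthRatCode
  refine Computable.fun_nat_rec (h := fun _ _ k => Nat.find (exists_isRatCode_ge (k + 1)))
    (by fun_prop) (by fun_prop) ?_
  exact hfind.comp (by fun_prop)

theorem ratCode_ofNat (n : ℕ) : ratCode (Denumerable.ofNat ℚ n) = nthRatCode n := by
  let e1 := Rat.instEncodable
  let := @decidableRangeEncode ℚ Rat.instEncodable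
  let : Infinite (Set.range (@encode ℚ Rat.instEncodable)) :=
    Infinite.of_injective _ (Equiv.ofInjective _ (@encode_injective ℚ Rat.instEncodable)).injective
  have h1 : ratCode (Denumerable.ofNat ℚ n) =
      (Nat.Subtype.ofNat (Set.range (@encode ℚ Rat.instEncodable)) n).1 := by
    set s := (Nat.Subtype.ofNat (Set.range (@encode ℚ Rat.instEncodable)) n)
    have : @Denumerable.ofNat ℚ _ n = (@equivRangeEncode ℚ Rat.instEncodable).symm s := by
      unfold Rat.instDenumerable Denumerable.ofEncodableOfInfinite
      rw [Denumerable.ofEquiv_ofNat]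
      unfold Nat.Subtype.denumerable
      rw [Denumerable.ofEquiv_ofNat]
      rfl
    rw [this]
    exact congrArg Subtype.val ((@equivRangeEncode ℚ Rat.instEncodable).apply_symm_apply s)
  rw [h1]
  clear h1
  have hmem : ∀ k, k ∈ Set.range (@encode ℚ Rat.instEncodable) ↔ isRatCode k = true :=
    fun k => (isRatCode_iff k).symm
  induction n with
  | zero =>
    refine le_antisymm ?_ ?_
    · have hs := Nat.find_spec (exists_isRatCode_ge 0)
      rw [Bool.and_eq_true, ← hmem] at hs
      exact (bot_le : (⊥ : Set.range (@encode ℚ Rat.instEncodable)) ≤ ⟨_, hs.2⟩)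
    · refine Nat.find_min' (exists_isRatCode_ge 0) ?_
      simp [← hmem, (Nat.Subtype.ofNat (Set.range (@encode ℚ Rat.instEncodable)) 0).2]
  | succ n ih =>
    have hstep : nthRatCode (n + 1) = Nat.find (exists_isRatCode_ge (nthRatCode n + 1)) := rfl
    have hs := Nat.find_spec (exists_isRatCode_ge (nthRatCode n + 1))
    rw [Bool.and_eq_true, ← hmem, decide_eq_true_eq] at hs
    rw [hstep]
    refine le_antisymm ?_ ?_
    · have hlt : Nat.Subtype.ofNat (Set.range (@encode ℚ Rat.instEncodable)) n < ⟨_, hs.2⟩ := by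
        rw [← Subtype.coe_lt_coe, ih]
        exact hs.1
      exact Nat.Subtype.succ_le_of_lt hlt
    · refine Nat.find_min' _ ?_
      rw [Bool.and_eq_true, ← hmem, decide_eq_true_eq, ← ih]
      exact ⟨Nat.Subtype.lt_succ_self _,
        (Nat.Subtype.ofNat (Set.range (@encode ℚ Rat.instEncodable)) (n + 1)).2⟩

theorem computable_ratCode : Computable ratCode := by
  refine (computable_nthRatCode.comp Computable.encode).of_eq fun q => ?_
  rw [← ratCode_ofNat, Denumerable.ofNat_encode]

theorem Computable.rat_den : Computable Rat.den :=
  (show Computable fun q => (ratCode q).unpair.2 by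
    have := computable_ratCode
    fun_prop).of_eq fun q => by simp [ratCode]

theorem Computable.rat_num_toNat : Computable fun q : ℚ => q.num.toNat := by
  have h : Computable fun q =>
      bif decide ((ratCode q).unpair.1 % 2 = 0) then (ratCode q).unpair.1 / 2 else 0 := by
    have := computable_ratCode
    fun_prop
  refine h.of_eq fun q => ?_
  simp only [ratCode, Nat.unpair_pair]
  rcases q.num with z | z
  · rw [Int.ofNat_eq_natCast, encode_int_ofNat]; simp
  · rw [encode_int_negSucc]; simp

theorem Computable.rat_div {α : Type*} [Primcodable α] {f g : α → ℕ} (hf : Computable f)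
    (hg : Computable g) (hpos : ∀ a, 0 < g a) : Computable fun a => ((f a : ℚ) / g a) := by
  let p : α → ℕ → Bool := fun a k =>
    decide ((nthRatCode k).unpair.1 % 2 = 0) &&
      decide ((nthRatCode k).unpair.1 / 2 * g a = f a * (nthRatCode k).unpair.2)
  have hp : ∀ a k, p a k = true ↔ Denumerable.ofNat ℚ k = (f a : ℚ) / g a := by
    intro a k
    have hg0 : (g a : ℚ) ≠ 0 := by exact_mod_cast (hpos a).ne'
    set q := Denumerable.ofNat ℚ k with hq
    have hd0 : (q.den : ℚ) ≠ 0 := by exact_mod_cast q.den_nz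
    have hiff : q = (f a : ℚ) / g a ↔ q.num * (g a : ℤ) = f a * q.den := by
      rw [eq_div_iff hg0]
      conv_lhs => rw [← Rat.num_div_den q]
      rw [div_mul_eq_mul_div, div_eq_iff hd0]
      exact_mod_cast Iff.rfl
    rw [hiff]
    simp only [p, ← ratCode_ofNat, ← hq, ratCode, Nat.unpair_pair, Bool.and_eq_true,
      decide_eq_true_eq]
    have hneg : ∀ z : ℕ, Int.negSucc z * (g a : ℤ) ≠ f a * q.den := by
      intro z hz
      have h1 : Int.negSucc z * (g a : ℤ) < 0 :=
        mul_neg_of_neg_of_pos (Int.negSucc_lt_zero z) (by exact_mod_cast hpos a)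
      have h2 : (0 : ℤ) ≤ f a * q.den := by positivity
      omega
    rcases q.num with z | z
    · rw [Int.ofNat_eq_natCast, encode_int_ofNat]
      have : 2 * z / 2 = z := by omega
      rw [this]
      constructor
      · intro h; exact_mod_cast h.2
      · intro h; exact ⟨by omega, by exact_mod_cast h⟩
    · rw [encode_int_negSucc]
      constructor
      · intro h; omega
      · intro h; exact absurd h (hneg z)
  have hex : ∀ a, ∃ k, p a k = true := fun a =>
    ⟨@encode ℚ Denumerable.toEncodable ((f a : ℚ) / g a), by rw [hp, Denumerable.ofNat_encode]⟩
  have hc : Computable fun a => Denumerable.ofNat ℚ (Nat.find (hex a)) := by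
    refine (Computable.ofNat ℚ).comp (Computable.nat_find ?_ hex)
    have := computable_nthRatCode
    fun_prop
  exact hc.of_eq fun a => (hp a _).1 (Nat.find_spec (hex a))

end RationalCoding

section Bits

theorem floor_mul_two_pow_of_le (x : ℝ) {m n : ℕ} (hmn : m ≤ n) :
    ⌊x * 2 ^ m⌋₊ = ⌊x * 2 ^ n⌋₊ / 2 ^ (n - m) := by
  have h : x * 2 ^ m = x * 2 ^ n / ((2 ^ (n - m) : ℕ) : ℝ) := by
    rw [eq_div_iff (by positivity), Nat.cast_pow, Nat.cast_ofNat, mul_assoc, ← pow_add,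
      Nat.add_sub_cancel' hmn]
  rw [h, Nat.floor_div_natCast]

theorem rdigit_eq_natFloor {x : ℝ} (hx : 0 ≤ x) (i : ℕ) :
    rdigit x i = decide (⌊x * 2 ^ (i + 1)⌋₊ % 2 = 1) := by
  have h : (⌊x * 2 ^ (i + 1)⌋₊ : ℤ) = ⌊x * 2 ^ (i + 1)⌋ :=
    Int.natCast_floor_eq_floor (by positivity)
  unfold rdigit
  rw [← h, decide_eq_decide]
  omega

theorem bits_eq_of_floor_eq {x y : ℝ} (hx : 0 ≤ x) (hy : 0 ≤ y) {n : ℕ}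
    (h : ⌊x * 2 ^ n⌋₊ = ⌊y * 2 ^ n⌋₊) : bits x n = bits y n := by
  refine List.map_congr_left fun i hi => ?_
  have hi' : i + 1 ≤ n := List.mem_range.1 hi
  rw [rdigit_eq_natFloor hx, rdigit_eq_natFloor hy, floor_mul_two_pow_of_le x hi',
    floor_mul_two_pow_of_le y hi', h]

/-- The number whose binary expansion is the given string. -/
def bitsVal (L : List Bool) : ℕ := L.foldl (fun v b => 2 * v + b.toNat) 0

theorem bitsVal_bits {x : ℝ} (h0 : 0 ≤ x) (h1 : x < 1) (n : ℕ) :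
    bitsVal (bits x n) = ⌊x * 2 ^ n⌋₊ := by
  induction n with
  | zero =>
    rw [pow_zero, mul_one, Nat.floor_eq_zero.2 h1]
    rfl
  | succ n ih =>
    have h : bitsVal (bits x (n + 1)) = 2 * bitsVal (bits x n) + (rdigit x n).toNat := by
      simp [bits, bitsVal, List.range_succ]
    rw [h, ih, rdigit_eq_natFloor h0, floor_mul_two_pow_of_le x (Nat.le_succ n)]
    rcases Nat.mod_two_eq_zero_or_one ⌊x * 2 ^ (n + 1)⌋₊ with h2 | h2 <;> simp [h2] <;> omega

theorem computable_bitsVal : Computable bitsVal := by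
  refine (Primrec.list_foldl (f := fun L : List Bool => L) (g := fun _ => 0)
    (h := fun _ p => 2 * p.1 + p.2.toNat) Primrec.id (Primrec.const 0) ?_).to_comp
  refine Primrec.nat_add.comp (Primrec.nat_mul.comp (Primrec.const 2)
    (Primrec.fst.comp Primrec.snd)) ((Primrec.dom_bool Bool.toNat).comp
      (Primrec.snd.comp Primrec.snd))

/-- The first `k` binary digits of the fraction `N / D`. -/
def fracBits (N D k : ℕ) : List Bool :=
  (List.range k).map fun i => decide (N * 2 ^ (i + 1) / D % 2 = 1)

theorem fracBits_eq (N D k : ℕ) : fracBits N D k = bits ((N : ℝ) / D) k := by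
  refine List.map_congr_left fun i _ => ?_
  rw [rdigit_eq_natFloor (by positivity), decide_eq_decide]
  have h : (N : ℝ) / D * 2 ^ (i + 1) = ((N * 2 ^ (i + 1) : ℕ) : ℝ) / D := by
    push_cast; ring
  rw [h, Nat.floor_div_natCast, Nat.floor_natCast]

theorem computable_fracBits {α : Type*} [Primcodable α] {N D k : α → ℕ} (hN : Computable N)
    (hD : Computable D) (hk : Computable k) :
    Computable fun x => fracBits (N x) (D x) (k x) := by
  refine Computable.list_map_range
    (g := fun x i => decide (N x * 2 ^ (i + 1) / D x % 2 = 1)) hk ?_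
  fun_prop

end Bits

section LeftCE

open Filter Topology

theorem exists_fraction_approx {γ : ℝ} (hγ : γ ∈ Set.Icc (0 : ℝ) 1) (hce : LeftCE γ) :
    ∃ N D : ℕ → ℕ, Computable N ∧ Computable D ∧
      Monotone (fun u => (N u : ℝ) / D u) ∧ (∀ u, (N u : ℝ) / D u < 1) ∧
      ∀ k, ∀ᶠ u in atTop, bits ((N u : ℝ) / D u) k = bits γ k := by
  obtain ⟨h0, h1⟩ := hγ
  rcases h1.eq_or_lt with rfl | h1
  · refine ⟨fun _ => 0, fun _ => 1, Computable.const _, Computable.const _,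
      fun _ _ _ => le_rfl, fun _ => by simp, fun k => Eventually.of_forall fun u => ?_⟩
    refine List.map_congr_left fun i _ => ?_
    have h : ⌊(2 : ℝ) ^ (i + 1)⌋₊ = 2 ^ (i + 1) := by
      have := Nat.floor_natCast (R := ℝ) (2 ^ (i + 1))
      simpa using this
    rw [rdigit_eq_natFloor (by positivity), rdigit_eq_natFloor zero_le_one, one_mul, h]
    simp [pow_succ]
  by_cases hdy : ∃ m k : ℕ, γ * 2 ^ k = m
  · obtain ⟨m, k, hmk⟩ := hdy
    have hγ : γ = (m : ℝ) / ((2 ^ k : ℕ) : ℝ) := by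
      rw [← hmk]; push_cast; field_simp
    refine ⟨fun _ => m, fun _ => 2 ^ k, Computable.const _, Computable.const _,
      fun _ _ _ => le_rfl, fun _ => hγ ▸ h1, fun k => Eventually.of_forall fun u => ?_⟩
    rw [hγ]
  · obtain ⟨q, hqc, hqm, hqt⟩ := hce
    have hpos : 0 < γ := by
      refine lt_of_le_of_ne h0 fun h => hdy ⟨0, 0, by simp [← h]⟩
    obtain ⟨u₀, hu₀⟩ := eventually_atTop.1 (hqt.eventually (lt_mem_nhds hpos))
    have hmono : Monotone fun u => (q u : ℝ) := fun u v huv =>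
      Rat.cast_le.2 (hqm huv)
    have hle : ∀ u, (q u : ℝ) ≤ γ := fun u => hmono.ge_of_tendsto hqt u
    have hval : ∀ u, (((q (u + u₀)).num.toNat : ℕ) : ℝ) / ((q (u + u₀)).den : ℕ) =
        (q (u + u₀) : ℝ) := by
      intro u
      have hq : 0 ≤ (q (u + u₀)).num := by
        have := hu₀ (u + u₀) (by omega)
        exact Rat.num_nonneg.2 (by exact_mod_cast this.le)
      conv_rhs => rw [Rat.cast_def]
      congr 1
      have : ((q (u + u₀)).num.toNat : ℤ) = (q (u + u₀)).num := Int.toNat_of_nonneg hq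
      exact_mod_cast this
    refine ⟨fun u => (q (u + u₀)).num.toNat, fun u => (q (u + u₀)).den, ?_, ?_, ?_, ?_, ?_⟩
    · exact Computable.rat_num_toNat.comp (hqc.comp (by fun_prop))
    · exact Computable.rat_den.comp (hqc.comp (by fun_prop))
    · simp only [hval]
      intro u v huv
      exact hmono (by omega)
    · intro u
      rw [hval]
      exact (hle _).trans_lt h1
    · intro k
      simp only [hval]
      have hlt : (⌊γ * 2 ^ k⌋₊ : ℝ) < γ * 2 ^ k :=
        lt_of_le_of_ne (Nat.floor_le (by positivity)) fun h => hdy ⟨_, _, h.symm⟩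
      have ht : Tendsto (fun u => (q (u + u₀) : ℝ) * 2 ^ k) atTop (𝓝 (γ * 2 ^ k)) :=
        (hqt.comp (tendsto_add_atTop_nat u₀)).mul_const _
      filter_upwards [ht.eventually (lt_mem_nhds hlt)] with u hu
      have hq0 : (0 : ℝ) ≤ q (u + u₀) := (hu₀ (u + u₀) (by omega)).le
      refine bits_eq_of_floor_eq hq0 h0 (le_antisymm ?_ ?_)
      · exact Nat.floor_mono (mul_le_mul_of_nonneg_right (hle _) (by positivity))
      · exact Nat.le_floor hu.le

theorem Monotone.exists_eventually_eq_nat {f : ℕ → ℕ} (hf : Monotone f) {B : ℕ}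
    (hB : ∀ n, f n ≤ B) : ∃ v, ∀ᶠ s in atTop, f s = v := by
  have hfin : (Set.range f).Finite :=
    (Set.finite_Iic B).subset (by rintro _ ⟨n, rfl⟩; exact hB n)
  obtain ⟨_, ⟨s₀, rfl⟩, hmax⟩ := Set.exists_max_image _ id hfin (Set.range_nonempty f)
  refine ⟨f s₀, eventually_atTop.2 ⟨s₀, fun s hs => le_antisymm ?_ (hf hs)⟩⟩
  exact hmax _ (Set.mem_range_self s)

theorem sum_Ico_div_two_pow_le {a b x : ℕ → ℕ} (hab : ∀ e, a e ≤ b e)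
    (hsucc : ∀ e, a (e + 1) = b e + 1) (hbd : ∀ e, x e < 2 ^ (b e - a e)) {k m : ℕ} (hkm : k ≤ m) :
    ∑ e ∈ Finset.Ico k m, (x e : ℝ) / 2 ^ b e ≤ 1 / 2 ^ a k - 1 / 2 ^ a m := by
  induction m, hkm using Nat.le_induction with
  | base => simp
  | succ m hkm ih =>
    rw [Finset.sum_Ico_succ_top hkm, hsucc]
    have h1 : (x m : ℝ) + 1 ≤ 2 ^ (b m - a m) := by exact_mod_cast hbd m
    have h2 : (x m : ℝ) / 2 ^ b m ≤ 1 / 2 ^ a m - 1 / 2 ^ b m := by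
      have h3 : (1 : ℝ) / 2 ^ a m = 2 ^ (b m - a m) / 2 ^ b m := by
        rw [div_eq_div_iff (by positivity) (by positivity), ← pow_add, one_mul,
          Nat.sub_add_cancel (hab m)]
      rw [h3, ← sub_div]
      gcongr
      linarith
    have h4 : (1 : ℝ) / 2 ^ (b m + 1) ≤ 1 / 2 ^ b m :=
      one_div_le_one_div_of_le (by positivity) (pow_le_pow_right₀ one_le_two (Nat.le_succ _))
    linarith

/-- Counters acting on disjoint blocks of binary digits assemble into a left-c.e. real. -/
theorem exists_leftCE_of_counters {a b : ℕ → ℕ} (ha : Computable a) (hb : Computable b)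
    (h0 : a 0 = 2) (hab : ∀ e, a e ≤ b e) (hsucc : ∀ e, a (e + 1) = b e + 1) {x : ℕ → ℕ → ℕ}
    (hx : Computable fun p : ℕ × ℕ => x p.1 p.2) (hmono : ∀ e, Monotone (x e))
    (hbd : ∀ e s, x e s < 2 ^ (b e - a e)) :
    ∃ α ∈ Set.Ioo (0 : ℝ) 1, LeftCE α ∧ ∀ e v, (∀ᶠ s in atTop, x e s = v) →
      ∀ n, a e < n → n ≤ b e → ⌊α * 2 ^ n⌋₊ % 2 ^ (n - a e) = v / 2 ^ (b e - n) := by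
  have hamono : Monotone a := monotone_nat_of_le_succ fun e => by rw [hsucc]; have := hab e; omega
  have hba : ∀ {e s}, e < s → b e < a s := fun {e s} hes => by
    have := hamono (Nat.succ_le_of_lt hes)
    rw [Nat.succ_eq_add_one, hsucc] at this
    omega
  have ha2 : ∀ s, 2 ≤ a s := fun s => h0 ▸ hamono (Nat.zero_le s)
  let r : ℕ → ℝ := fun s => 1 / 4 + ∑ e ∈ Finset.range s, (x e s : ℝ) / 2 ^ b e
  have hscale : ∀ {m e s : ℕ}, (∀ i < e, b i ≤ m) → 2 ≤ m →
      ((2 ^ (m - 2) + ∑ i ∈ Finset.range e, x i s * 2 ^ (m - b i) : ℕ) : ℝ) / 2 ^ m =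
        1 / 4 + ∑ i ∈ Finset.range e, (x i s : ℝ) / 2 ^ b i := by
    intro m e s hm hm2
    push_cast
    rw [add_div, Finset.sum_div]
    congr 1
    · rw [div_eq_div_iff (by positivity) (by norm_num), one_mul,
        show (4 : ℝ) = 2 ^ 2 by norm_num, ← pow_add, Nat.sub_add_cancel hm2]
    · refine Finset.sum_congr rfl fun i hi => ?_
      rw [div_eq_div_iff (by positivity) (by positivity), mul_assoc, ← pow_add,
        Nat.sub_add_cancel (hm i (Finset.mem_range.1 hi))]
  have hrmono : Monotone r := by
    intro s t hst
    refine add_le_add le_rfl ?_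
    calc ∑ e ∈ Finset.range s, (x e s : ℝ) / 2 ^ b e
        ≤ ∑ e ∈ Finset.range s, (x e t : ℝ) / 2 ^ b e := by
          refine Finset.sum_le_sum fun e _ => ?_
          have : x e s ≤ x e t := hmono e hst
          gcongr
      _ ≤ _ := Finset.sum_le_sum_of_subset_of_nonneg (Finset.range_mono hst)
          fun _ _ _ => by positivity
  have hsum : ∀ m s, 1 / 4 + ∑ i ∈ Finset.range m, (x i s : ℝ) / 2 ^ b i ≤ 1 / 2 := by
    intro m s
    have h1 := sum_Ico_div_two_pow_le (x := fun e => x e s) hab hsucc (fun e => hbd e s)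
      (Nat.zero_le m)
    rw [h0, ← Finset.range_eq_Ico] at h1
    have h2 : (0 : ℝ) ≤ 1 / 2 ^ a m := by positivity
    linarith
  have hrle : ∀ s, r s ≤ 1 / 2 := fun s => hsum s s
  have hbdd : BddAbove (Set.range r) := ⟨1 / 2, by rintro _ ⟨s, rfl⟩; exact hrle s⟩
  have ht : Tendsto r atTop (𝓝 (⨆ s, r s)) := tendsto_atTop_ciSup hrmono hbdd
  set α := ⨆ s, r s with hα
  have hα0 : 1 / 4 ≤ α := by
    have := hrmono.ge_of_tendsto ht 0
    simpa [r] using this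
  have hα1 : α ≤ 1 / 2 := le_of_tendsto' ht hrle
  refine ⟨α, ⟨by linarith, by linarith⟩, ?_, ?_⟩
  · let A : ℕ → ℕ := fun s => 2 ^ (a s - 2) + ∑ e ∈ Finset.range s, x e s * 2 ^ (a s - b e)
    have hA : Computable A := by
      refine Computable.nat_add (by fun_prop) (Computable.sum_range Computable.id ?_)
      refine Computable.nat_mul (hx.comp (Computable.snd.pair Computable.fst)) ?_
      fun_prop
    have hq : ∀ s, (((A s : ℚ) / (2 ^ a s : ℕ) : ℚ) : ℝ) = r s := by
      intro s
      have h1 : (A s : ℝ) / 2 ^ a s = r s := hscale (fun i hi => (hba hi).le) (ha2 s)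
      rw [← h1]
      push_cast
      rfl
    refine ⟨fun s => (A s : ℚ) / (2 ^ a s : ℕ), ?_, ?_, ?_⟩
    · exact Computable.rat_div (g := fun s => 2 ^ a s) hA (by fun_prop) fun s => by positivity
    · intro s t hst
      have := hrmono hst
      rw [← hq, ← hq] at this
      exact_mod_cast this
    · simpa only [hq] using ht
  · intro e v hv n hn1 hn2
    let K : ℕ → ℕ := fun s => 2 ^ (a e - 2) + ∑ i ∈ Finset.range e, x i s * 2 ^ (a e - b i)
    have hKr : ∀ s, (K s : ℝ) / 2 ^ a e =
        1 / 4 + ∑ i ∈ Finset.range e, (x i s : ℝ) / 2 ^ b i := fun s =>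
      hscale (fun i hi => (hba hi).le) (ha2 e)
    have hKmono : Monotone K := by
      intro s t hst
      refine Nat.add_le_add_left (Finset.sum_le_sum fun i _ => ?_) _
      exact Nat.mul_le_mul_right _ (hmono i hst)
    have hKbd : ∀ s, K s ≤ 2 ^ a e := by
      intro s
      have h4 : (K s : ℝ) / 2 ^ a e ≤ 1 := by
        rw [hKr s]
        linarith [hsum e s]
      rw [div_le_one (by positivity)] at h4
      exact_mod_cast h4
    obtain ⟨k, hk⟩ := hKmono.exists_eventually_eq_nat hKbd
    have hv' : v < 2 ^ (b e - a e) := by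
      obtain ⟨s, hs⟩ := hv.exists
      exact hs ▸ hbd e s
    have hbounds : ∀ᶠ s in atTop, (k : ℝ) / 2 ^ a e + v / 2 ^ b e ≤ r s ∧
        r s ≤ (k : ℝ) / 2 ^ a e + v / 2 ^ b e + 1 / 2 ^ (b e + 1) := by
      filter_upwards [hv, hk, eventually_gt_atTop e] with s hs hks hes
      have h1 := hKr s
      rw [hks] at h1
      have h2 : r s = (k : ℝ) / 2 ^ a e + v / 2 ^ b e +
          ∑ i ∈ Finset.Ico (e + 1) s, (x i s : ℝ) / 2 ^ b i := by
        simp only [r]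
        rw [h1, ← Finset.sum_range_add_sum_Ico _ (Nat.succ_le_of_lt hes), Finset.sum_range_succ,
          hs]
        ring
      have h3 := sum_Ico_div_two_pow_le (x := fun e => x e s) hab hsucc (fun e => hbd e s)
        (Nat.succ_le_of_lt hes)
      rw [Nat.succ_eq_add_one, hsucc] at h3
      have h4 : (0 : ℝ) ≤ 1 / 2 ^ a s := by positivity
      have h5 : 0 ≤ ∑ i ∈ Finset.Ico (e + 1) s, (x i s : ℝ) / 2 ^ b i :=
        Finset.sum_nonneg fun _ _ => by positivity
      constructor <;> linarith
    have hlow := ge_of_tendsto ht (hbounds.mono fun _ h => h.1)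
    have hupp := le_of_tendsto ht (hbounds.mono fun _ h => h.2)
    have hfloor : ⌊α * 2 ^ b e⌋₊ = k * 2 ^ (b e - a e) + v := by
      have hbe : (2 : ℝ) ^ b e = 2 ^ a e * 2 ^ (b e - a e) := by
        rw [← pow_add, Nat.add_sub_cancel' (hab e)]
      have hcalc : ((k : ℝ) / 2 ^ a e + v / 2 ^ b e) * 2 ^ b e = k * 2 ^ (b e - a e) + v := by
        rw [add_mul, div_mul_cancel₀ _ (by positivity), hbe, div_mul_eq_mul_div]
        field_simp
      rw [Nat.floor_eq_iff (by positivity)]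
      push_cast
      constructor
      · rw [← hcalc]
        gcongr
      · have h1 : α * 2 ^ b e ≤
            ((k : ℝ) / 2 ^ a e + v / 2 ^ b e) * 2 ^ b e + 1 / 2 ^ (b e + 1) * 2 ^ b e := by
          rw [← add_mul]
          gcongr
        have h2 : (1 : ℝ) / 2 ^ (b e + 1) * 2 ^ b e = 1 / 2 := by
          rw [pow_succ]; field_simp
        rw [hcalc, h2] at h1
        linarith
    have hsplit : b e - a e = (b e - n) + (n - a e) := by omega
    rw [floor_mul_two_pow_of_le α hn2, hfloor, hsplit, pow_add, ← mul_assoc, mul_right_comm,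
      mul_comm (k * _), Nat.mul_add_div (by positivity), Nat.mul_add_mod_self_right]
    refine Nat.mod_eq_of_lt (Nat.div_lt_of_lt_mul ?_)
    rwa [← pow_add, ← hsplit]

end LeftCE

section Game

open Filter

theorem padicValNat_two_pow_add {w i : ℕ} (hi0 : i ≠ 0) (hi : i < 2 ^ w) :
    padicValNat 2 (2 ^ w + i) = padicValNat 2 i := by
  have hlt : padicValNat 2 i < w := by
    by_contra! hle
    have h1 : 2 ^ w ∣ i := (pow_dvd_pow 2 hle).trans pow_padicValNat_dvd
    exact absurd (Nat.le_of_dvd (Nat.pos_of_ne_zero hi0) h1) (not_le.2 hi)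
  have hdvd : ∀ m, m ≤ w → (2 ^ m ∣ 2 ^ w + i ↔ 2 ^ m ∣ i) := fun m hm =>
    Nat.dvd_add_right (pow_dvd_pow 2 hm)
  refine le_antisymm ?_ ?_
  · by_contra! hgt
    have h1 : 2 ^ (padicValNat 2 i + 1) ∣ 2 ^ w + i :=
      (pow_dvd_pow 2 hgt).trans pow_padicValNat_dvd
    rw [hdvd _ hlt] at h1
    exact pow_succ_padicValNat_not_dvd hi0 h1
  · rw [← padicValNat_dvd_iff_le (by omega), hdvd _ hlt.le]
    exact pow_padicValNat_dvd

theorem sum_padicValNat_two (f : ℕ → ℝ) (w : ℕ) :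
    ∑ j ∈ Finset.range (2 ^ w - 1), f (padicValNat 2 (j + 1)) =
      ∑ i ∈ Finset.range w, 2 ^ (w - 1 - i) * f i := by
  induction w with
  | zero => simp
  | succ w ih =>
    have hpos : 0 < 2 ^ w := by positivity
    have hsplit : 2 ^ (w + 1) - 1 = (2 ^ w - 1 + 1) + (2 ^ w - 1) := by
      rw [pow_succ]; omega
    have htail : ∑ j ∈ Finset.range (2 ^ w - 1), f (padicValNat 2 (2 ^ w - 1 + 1 + j + 1)) =
        ∑ j ∈ Finset.range (2 ^ w - 1), f (padicValNat 2 (j + 1)) := by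
      refine Finset.sum_congr rfl fun j hj => ?_
      have hj' := Finset.mem_range.1 hj
      rw [Nat.sub_add_cancel hpos, add_assoc, padicValNat_two_pow_add (by omega) (by omega)]
    rw [hsplit, Finset.sum_range_add, htail, Finset.sum_range_succ, Nat.sub_add_cancel hpos,
      padicValNat.prime_pow, ih, Finset.sum_range_succ]
    have hdouble : ∑ i ∈ Finset.range w, 2 ^ (w + 1 - 1 - i) * f i =
        2 * ∑ i ∈ Finset.range w, 2 ^ (w - 1 - i) * f i := by
      rw [Finset.mul_sum]
      refine Finset.sum_congr rfl fun i hi => ?_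
      have hi' := Finset.mem_range.1 hi
      rw [← mul_assoc, ← pow_succ', show w + 1 - 1 - i = w - 1 - i + 1 by omega]
    rw [hdouble]
    simp only [Nat.add_sub_cancel, Nat.sub_self, pow_zero, one_mul]
    ring

theorem div_two_pow_padicValNat_succ_ne (j : ℕ) :
    j / 2 ^ padicValNat 2 (j + 1) ≠ (j + 1) / 2 ^ padicValNat 2 (j + 1) := by
  set P := 2 ^ padicValNat 2 (j + 1) with hP
  have hpos : 0 < P := by positivity
  obtain ⟨m, hm⟩ : P ∣ j + 1 := pow_padicValNat_dvd
  have h1 : j / P < m := Nat.div_lt_of_lt_mul (by omega)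
  have h2 : (j + 1) / P = m := by rw [hm, Nat.mul_div_cancel_left _ hpos]
  rw [h2]
  exact h1.ne

/-- A lower bound which a monotone opponent has to meet in order to answer the first `t` moves,
where moves `2 * j` and `2 * j + 1` both force a change within the first `K j` digits. -/
def MeetsBound (K : ℕ → ℕ) (t : ℕ) (y : ℝ) : Prop :=
  if t % 2 = 0 then ∑ j ∈ Finset.range (t / 2), 1 / 2 ^ K j ≤ y
  else ⌊(∑ j ∈ Finset.range (t / 2), 1 / (2 : ℝ) ^ K j) * 2 ^ K (t / 2)⌋₊ + 1 ≤
    ⌊y * 2 ^ K (t / 2)⌋₊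

theorem MeetsBound.mono {K : ℕ → ℕ} {t : ℕ} {y z : ℝ} (h : MeetsBound K t y) (hyz : y ≤ z) :
    MeetsBound K t z := by
  unfold MeetsBound at h ⊢
  split_ifs at h ⊢ with ht
  · exact h.trans hyz
  · exact h.trans (Nat.floor_mono (by gcongr))

theorem MeetsBound.succ {K : ℕ → ℕ} {t : ℕ} {y z : ℝ} (h : MeetsBound K t y)
    (hyz : ⌊y * 2 ^ K (t / 2)⌋₊ < ⌊z * 2 ^ K (t / 2)⌋₊) : MeetsBound K (t + 1) z := by
  unfold MeetsBound at h ⊢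
  rcases Nat.mod_two_eq_zero_or_one t with ht | ht
  · have h1 : (t + 1) % 2 ≠ 0 := by omega
    have h2 : (t + 1) / 2 = t / 2 := by omega
    rw [if_pos ht] at h
    rw [if_neg h1, h2]
    have := Nat.floor_mono (mul_le_mul_of_nonneg_right h (by positivity : 0 ≤ (2 : ℝ) ^ K (t / 2)))
    omega
  · have h1 : (t + 1) % 2 = 0 := by omega
    have h2 : (t + 1) / 2 = t / 2 + 1 := by omega
    rw [if_neg (by omega)] at h
    rw [if_pos h1, h2, Finset.sum_range_succ]
    set L := ∑ j ∈ Finset.range (t / 2), 1 / (2 : ℝ) ^ K j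
    set P := (2 : ℝ) ^ K (t / 2)
    have hP : 0 < P := by positivity
    have h3 : ⌊L * P⌋₊ + 2 ≤ ⌊z * P⌋₊ := by omega
    have h4 := Nat.lt_floor_add_one (L * P)
    have h5 : (⌊z * P⌋₊ : ℝ) ≤ z * P := by
      refine Nat.floor_le (Nat.pos_of_floor_pos ?_).le
      omega
    have h6 : (⌊L * P⌋₊ : ℝ) + 2 ≤ ⌊z * P⌋₊ := by exact_mod_cast h3
    refine le_of_mul_le_mul_right ?_ hP
    rw [add_mul, one_div_mul_cancel hP.ne']
    linarith

theorem meetsBound_of_responses {K : ℕ → ℕ} {g : ℕ → ℝ} (hg : Monotone g) (hg0 : 0 ≤ g 0)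
    {R : ℕ → ℕ → Prop} {S : ℕ → ℕ} {T : ℕ} (hS0 : S 0 = 0)
    (hS : ∀ u, S (u + 1) = S u ∨ R u (S u) ∧ S (u + 1) = S u + 1)
    (hstep : ∀ t < T, ∀ u u', u ≤ u' → R u t → R u' (t + 1) →
      ⌊g u * 2 ^ K (t / 2)⌋₊ < ⌊g u' * 2 ^ K (t / 2)⌋₊) :
    ∀ u, S u ≤ T → ∀ u' ≥ u, R u' (S u) → MeetsBound K (S u) (g u') := by
  intro u
  induction u with
  | zero =>
    intro _ u' _ _
    rw [hS0]
    simpa [MeetsBound] using hg0.trans (hg (Nat.zero_le u'))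
  | succ u ih =>
    intro hT u' hu' hR
    rcases hS u with h | ⟨hR', h⟩
    · rw [h] at hT hR ⊢
      exact ih hT u' (by omega) hR
    · rw [h] at hT hR ⊢
      exact (ih (by omega) u le_rfl hR').succ (hstep _ (by omega) u u' (by omega) hR' hR)

/-- The outputs `o₁ n` and `o₂ n` exhibit, on the digits in positions `a < n ≤ b`, the values of
the two counters after `t` moves. -/
def Exhibits (a b : ℕ) (o₁ o₂ : ℕ → Option ℕ) (t : ℕ) : Prop :=
  ∀ i < b - a,
    (∃ v ∈ o₁ (a + 1 + i), v % 2 ^ (i + 1) = (t + 1) / 2 / 2 ^ (b - (a + 1 + i))) ∧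
      ∃ v ∈ o₂ (a + 1 + i), v % 2 ^ (i + 1) = t / 2 / 2 ^ (b - (a + 1 + i))

theorem not_exhibits_all_moves {a b : ℕ} {K : ℕ → ℕ} {g : ℕ → ℝ} (hg : Monotone g)
    (hg0 : 0 ≤ g 0) (hg1 : ∀ u, g u < 1) {o₁ o₂ : ℕ → ℕ → Option ℕ}
    (ho₁ : ∀ u u' n, ⌊g u * 2 ^ K n⌋₊ = ⌊g u' * 2 ^ K n⌋₊ →
      ∀ v ∈ o₁ u n, ∀ v' ∈ o₁ u' n, v = v')
    (ho₂ : ∀ u u' n, ⌊g u * 2 ^ K n⌋₊ = ⌊g u' * 2 ^ K n⌋₊ →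
      ∀ v ∈ o₂ u n, ∀ v' ∈ o₂ u' n, v = v')
    (hsum : 1 ≤ ∑ i ∈ Finset.range (b - a), (2 : ℝ) ^ i / 2 ^ K (a + 1 + i))
    {S : ℕ → ℕ} (hS0 : S 0 = 0)
    (hS : ∀ u, S (u + 1) = S u ∨ Exhibits a b (o₁ u) (o₂ u) (S u) ∧ S (u + 1) = S u + 1)
    {u : ℕ} (hu : S u = 2 * (2 ^ (b - a) - 1)) :
    ¬ ∀ᶠ u' in atTop, Exhibits a b (o₁ u') (o₂ u') (S u) := by
  intro hev
  obtain ⟨u', hR, huu'⟩ := (hev.and (eventually_ge_atTop u)).exists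
  have hmain := meetsBound_of_responses (K := fun j => K (b - padicValNat 2 (j + 1))) hg hg0
    (R := fun u t => Exhibits a b (o₁ u) (o₂ u) t) (T := 2 * (2 ^ (b - a) - 1)) hS0 hS ?_
    u hu.le u' huu' hR
  · have h1 : 2 * (2 ^ (b - a) - 1) / 2 = 2 ^ (b - a) - 1 := by omega
    rw [hu, MeetsBound, if_pos (by omega), h1,
      sum_padicValNat_two (fun i => 1 / 2 ^ K (b - i)), ← Finset.sum_range_reflect] at hmain
    have h2 : ∑ i ∈ Finset.range (b - a), (2 : ℝ) ^ i / 2 ^ K (a + 1 + i) =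
        ∑ i ∈ Finset.range (b - a), (2 : ℝ) ^ (b - a - 1 - (b - a - 1 - i)) *
          (1 / 2 ^ K (b - (b - a - 1 - i))) := by
      refine Finset.sum_congr rfl fun i hi => ?_
      have hi' := Finset.mem_range.1 hi
      rw [show b - a - 1 - (b - a - 1 - i) = i by omega,
        show b - (b - a - 1 - i) = a + 1 + i by omega, mul_one_div]
    rw [← h2] at hmain
    linarith [hg1 u']
  · intro t ht u u' huu' hR hR'
    have hj0 : t / 2 + 1 < 2 ^ (b - a) := by omega
    have hval : padicValNat 2 (t / 2 + 1) < b - a := by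
      refine (Nat.pow_lt_pow_iff_right one_lt_two).1 (lt_of_le_of_lt ?_ hj0)
      exact Nat.le_of_dvd (Nat.succ_pos _) pow_padicValNat_dvd
    have hne := div_two_pow_padicValNat_succ_ne (t / 2)
    refine lt_of_le_of_ne (Nat.floor_mono (by have := hg huu'; gcongr)) fun heq => hne ?_
    have hn : b - padicValNat 2 (t / 2 + 1) =
        a + 1 + (b - a - 1 - padicValNat 2 (t / 2 + 1)) := by omega
    have hexp : b - (a + 1 + (b - a - 1 - padicValNat 2 (t / 2 + 1))) =
        padicValNat 2 (t / 2 + 1) := by omega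
    have hi : b - a - 1 - padicValNat 2 (t / 2 + 1) < b - a := by omega
    obtain ⟨⟨v₁, hv₁, e₁⟩, v₂, hv₂, e₂⟩ := hR _ hi
    obtain ⟨⟨w₁, hw₁, f₁⟩, w₂, hw₂, f₂⟩ := hR' _ hi
    rw [hexp] at e₁ e₂ f₁ f₂
    simp only [hn] at heq
    rw [ho₁ _ _ _ heq _ hv₁ _ hw₁, f₁] at e₁
    rw [ho₂ _ _ _ heq _ hv₂ _ hw₂, f₂] at e₂
    rcases Nat.mod_two_eq_zero_or_one t with h | h
    · have q₁ : (t + 1) / 2 = t / 2 := by omega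
      have q₂ : (t + 1 + 1) / 2 = t / 2 + 1 := by omega
      rw [q₁, q₂] at e₁
      exact e₁.symm
    · have q : (t + 1) / 2 = t / 2 + 1 := by omega
      rw [q] at e₂
      exact e₂.symm

end Game

section Opponent

open Filter Encodable

/-- Stage-wise approximations to the values computed from `γ` with oracle-use `k`. -/
theorem exists_output_approx {Φ : List Bool →. List Bool} (hΦ : Partrec Φ) {N D k : ℕ → ℕ}
    (hN : Computable N) (hD : Computable D) (hk : Computable k) {α γ : ℝ}
    (hα : α ∈ Set.Ioo (0 : ℝ) 1)
    (hlim : ∀ m, ∀ᶠ u in atTop, bits ((N u : ℝ) / D u) m = bits γ m)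
    (hcomp : ∀ n, Φ (bits γ (k n)) = Part.some (bits α n)) :
    ∃ o : ℕ → ℕ → Option ℕ, (Computable fun p : ℕ × ℕ => o p.1 p.2) ∧
      (∀ u u' n, ⌊(N u : ℝ) / D u * 2 ^ k n⌋₊ = ⌊(N u' : ℝ) / D u' * 2 ^ k n⌋₊ →
        ∀ v ∈ o u n, ∀ v' ∈ o u' n, v = v') ∧
      ∀ n, ∀ᶠ u in atTop, ⌊α * 2 ^ n⌋₊ ∈ o u n := by
  have hF : Partrec fun L => (Φ L).map bitsVal :=
    hΦ.map (computable_bitsVal.comp Computable.snd).to₂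
  obtain ⟨code, hcode⟩ := Nat.Partrec.Code.exists_code.1 hF
  have heval : ∀ L, code.eval (encode L) = (Φ L).map bitsVal := by
    intro L
    rw [hcode]
    simp only [encodek, Part.coe_some, Part.bind_some]
    exact Part.map_id' (fun _ => rfl) _
  refine ⟨fun u n => code.evaln u (encode (fracBits (N u) (D u) (k n))), ?_, ?_, ?_⟩
  · have := computable_fracBits (α := ℕ × ℕ) (N := fun p => N p.1) (D := fun p => D p.1)
      (k := fun p => k p.2) (by fun_prop) (by fun_prop) (by fun_prop)
    fun_prop
  · intro u u' n h v hv v' hv'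
    simp only [fracBits_eq] at hv hv'
    rw [bits_eq_of_floor_eq (by positivity) (by positivity) h] at hv
    exact Part.mem_unique (Nat.Partrec.Code.evaln_sound hv) (Nat.Partrec.Code.evaln_sound hv')
  · intro n
    have hmem : ⌊α * 2 ^ n⌋₊ ∈ code.eval (encode (bits γ (k n))) := by
      rw [heval, hcomp, Part.map_some, bitsVal_bits hα.1.le hα.2]
      exact Part.mem_some _
    obtain ⟨u₀, hu₀⟩ := Nat.Partrec.Code.evaln_complete.1 hmem
    filter_upwards [hlim (k n), eventually_ge_atTop u₀] with u hu huu
    simp only [fracBits_eq, hu]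
    exact Nat.Partrec.Code.evaln_mono huu hu₀

/-- Decides `Exhibits`. -/
def exhibits (a b : ℕ) (o₁ o₂ : ℕ → Option ℕ) (t : ℕ) : Bool :=
  decide (∑ i ∈ Finset.range (b - a), (1 -
    (((o₁ (a + 1 + i)).isSome &&
      decide ((o₁ (a + 1 + i)).getD 0 % 2 ^ (i + 1) = (t + 1) / 2 / 2 ^ (b - (a + 1 + i)))) &&
    ((o₂ (a + 1 + i)).isSome &&
      decide ((o₂ (a + 1 + i)).getD 0 % 2 ^ (i + 1) = t / 2 / 2 ^ (b - (a + 1 + i))))).toNat) = 0)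

theorem exhibits_iff {a b : ℕ} {o₁ o₂ : ℕ → Option ℕ} {t : ℕ} :
    exhibits a b o₁ o₂ t = true ↔ Exhibits a b o₁ o₂ t := by
  have hopt : ∀ (o : Option ℕ) (p q : ℕ),
      (o.isSome && decide (o.getD 0 % p = q)) = true ↔ ∃ v ∈ o, v % p = q := by
    intro o p q
    cases o <;> simp
  have hbool : ∀ c d : Bool, 1 - (c && d).toNat = 0 ↔ c = true ∧ d = true := by decide
  rw [exhibits, decide_eq_true_eq, Finset.sum_eq_zero_iff]
  simp only [Finset.mem_range, hbool, hopt]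
  rfl

end Opponent

section Construction

open Filter Encodable Nat.Partrec

/-- Consecutive intervals `(a e, b e]` of positions, each long enough for the requirement with
constant `e.unpair.1`. -/
theorem exists_blocks {d : ℕ → ℕ} (hd : Computable d) (hmono : Monotone d)
    (hdiv : ¬ Summable fun n => 1 / (2 : ℝ) ^ d n) :
    ∃ a b : ℕ → ℕ, Computable a ∧ Computable b ∧ a 0 = 2 ∧ (∀ e, a e ≤ b e) ∧
      (∀ e, a (e + 1) = b e + 1) ∧
      ∀ e, 1 ≤ ∑ i ∈ Finset.range (b e - a e),
        (2 : ℝ) ^ i / 2 ^ (a e + 1 + i + d (a e + 1 + i) + e.unpair.1) := by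
  have hrec : ∀ a b c i, i < b - a → (2 : ℝ) ^ i / 2 ^ (a + 1 + i + d (a + 1 + i) + c) =
      ((2 ^ (d b - d (a + 1 + i)) : ℕ) : ℝ) / 2 ^ (a + 1 + c + d b) := by
    intro a b c i hi
    have hle : d (a + 1 + i) ≤ d b := hmono (by omega)
    rw [div_eq_div_iff (by positivity) (by positivity)]
    push_cast
    rw [← pow_add, ← pow_add]
    congr 1
    omega
  have hex : ∀ x : ℕ × ℕ, ∃ b, decide (2 ^ (x.1 + 1 + x.2 + d b) ≤
      ∑ i ∈ Finset.range (b - x.1), 2 ^ (d b - d (x.1 + 1 + i))) = true := by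
    rintro ⟨a, c⟩
    have hdiv' : ¬ Summable fun n => 1 / (2 : ℝ) ^ d (n + (a + 1)) :=
      fun hs => hdiv ((summable_nat_add_iff (f := fun n => 1 / (2 : ℝ) ^ d n) (a + 1)).1 hs)
    rw [not_summable_iff_tendsto_nat_atTop_of_nonneg (fun n => by positivity)] at hdiv'
    obtain ⟨m, hm⟩ := (hdiv'.eventually_ge_atTop ((2 : ℝ) ^ (a + 1 + c))).exists
    refine ⟨a + m, decide_eq_true ?_⟩
    have : ((2 : ℝ) ^ (a + 1 + c + d (a + m))) ≤
        ∑ i ∈ Finset.range (a + m - a), 2 ^ (d (a + m) - d (a + 1 + i)) := by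
      rw [pow_add]
      refine (mul_le_mul_of_nonneg_right hm (by positivity)).trans_eq ?_
      rw [Finset.sum_mul, Nat.add_sub_cancel_left]
      refine Finset.sum_congr rfl fun i hi => ?_
      have hi' := Finset.mem_range.1 hi
      have hle : d (i + (a + 1)) ≤ d (a + m) := hmono (by omega)
      rw [add_comm (a + 1) i, pow_sub₀ _ two_ne_zero hle]
      ring
    exact_mod_cast this
  have hspec := fun x => of_decide_eq_true (Nat.find_spec (hex x))
  have hfind : Computable fun x => Nat.find (hex x) := by
    refine Computable.nat_find ?_ hex
    have := Computable.sum_range (α := (ℕ × ℕ) × ℕ) (f := fun p => p.2 - p.1.1)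
      (g := fun p i => 2 ^ (d p.2 - d (p.1.1 + 1 + i))) (by fun_prop) (by fun_prop)
    fun_prop
  set B : ℕ × ℕ → ℕ := fun x => Nat.find (hex x) with hB
  have hle : ∀ x, x.1 ≤ B x := by
    intro x
    by_contra! hlt
    have h1 := hspec x
    rw [show Nat.find (hex x) - x.1 = 0 from Nat.sub_eq_zero_of_le hlt.le] at h1
    simp at h1
  set a : ℕ → ℕ := fun e => Nat.rec 2 (fun e v => B (v, e.unpair.1) + 1) e with ha
  have hca : Computable a := by
    have := Computable.fun_nat_rec (α := ℕ) (f := fun e => e) (g := fun _ => 2)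
      (h := fun _ u t => B (t, u.unpair.1) + 1) (by fun_prop) (by fun_prop) (by fun_prop)
    exact this
  refine ⟨a, fun e => B (a e, e.unpair.1), hca, by fun_prop, rfl, fun e => hle (a e, _),
    fun e => rfl, fun e => ?_⟩
  rw [Finset.sum_congr rfl fun i hi => hrec (a e) _ e.unpair.1 i (Finset.mem_range.1 hi),
    ← Finset.sum_div, one_le_div (by positivity)]
  exact_mod_cast hspec (a e, e.unpair.1)

/-- The number of requested moves, among the first `T`, which have been granted by stage `s`. -/
def countMoves (T e s : ℕ) : ℕ :=
  ∑ i ∈ Finset.range T,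
    (Code.evaln s (Denumerable.ofNat Code e.unpair.2) (Nat.pair e i)).isSome.toNat

theorem countMoves_le (T e s : ℕ) : countMoves T e s ≤ T := by
  refine (Finset.sum_le_card_nsmul _ _ 1 fun i _ => Bool.toNat_le _).trans ?_
  simp

theorem monotone_countMoves (T e : ℕ) : Monotone (countMoves T e) := by
  intro s s' hs
  refine Finset.sum_le_sum fun i _ => Bool.toNat_le_toNat fun h => ?_
  obtain ⟨v, hv⟩ := Option.isSome_iff_exists.1 h
  rw [Option.isSome_iff_exists]
  exact ⟨v, Code.evaln_mono hs hv⟩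

theorem computable_countMoves {T : ℕ → ℕ} (hT : Computable T) :
    Computable fun p : ℕ × ℕ => countMoves (T p.1) p.1 p.2 := by
  unfold countMoves
  exact Computable.sum_range (by fun_prop) (by fun_prop)

theorem exists_eventually_countMoves {P : ℕ → Prop} (hP : ∀ i j, i ≤ j → P j → P i) {e : ℕ}
    (hcode : ∀ i, ((Denumerable.ofNat Code e.unpair.2).eval (Nat.pair e i)).Dom ↔ P i) (T : ℕ) :
    ∃ t ≤ T, (∀ i < T, P i ↔ i < t) ∧ ∀ᶠ s in atTop, countMoves T e s = t := by
  have hhalt : ∀ i, ∀ᶠ s in atTop,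
      ((Code.evaln s (Denumerable.ofNat Code e.unpair.2) (Nat.pair e i)).isSome = true ↔ P i) := by
    intro i
    by_cases h : P i
    · obtain ⟨v, hv⟩ := Part.dom_iff_mem.1 ((hcode i).2 h)
      obtain ⟨s₀, hs₀⟩ := Code.evaln_complete.1 hv
      filter_upwards [eventually_ge_atTop s₀] with s hs
      simp only [h, iff_true]
      exact Option.isSome_iff_exists.2 ⟨v, Code.evaln_mono hs hs₀⟩
    · refine Eventually.of_forall fun s => ?_
      simp only [h, iff_false]
      intro hs
      obtain ⟨v, hv⟩ := Option.isSome_iff_exists.1 hs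
      exact h ((hcode i).1 (Part.dom_iff_mem.2 ⟨v, Code.evaln_sound hv⟩))
  induction T with
  | zero => exact ⟨0, le_rfl, by simp, Eventually.of_forall fun s => rfl⟩
  | succ T ih =>
    obtain ⟨t, htT, ht, hev⟩ := ih
    by_cases h : P T
    · refine ⟨T + 1, le_rfl, fun i hi => ⟨fun _ => hi, fun _ => hP _ _ (by omega) h⟩, ?_⟩
      have : t = T := by
        by_contra hne
        have h1 : t < T := by omega
        exact lt_irrefl t ((ht t h1).1 (hP _ _ h1.le h))
      filter_upwards [hev, hhalt T] with s hs hs'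
      rw [countMoves, Finset.sum_range_succ, ← countMoves, hs, hs'.2 h, this]
      rfl
    · refine ⟨t, by omega, fun i hi => ?_, ?_⟩
      · rcases Nat.lt_succ_iff_lt_or_eq.1 hi with hi | rfl
        · exact ht i hi
        · exact ⟨fun h' => absurd h' h, fun h' => by omega⟩
      filter_upwards [hev, hhalt T] with s hs hs'
      rw [countMoves, Finset.sum_range_succ, ← countMoves, hs,
        Bool.eq_false_iff.2 (mt hs'.1 h)]
      rfl

theorem exists_code_halts_iff {S : ℕ → ℕ → ℕ} (hS : Computable fun p : ℕ × ℕ => S p.1 p.2) :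
    ∃ code : Code, ∀ e i, (code.eval (Nat.pair e i)).Dom ↔ ∃ u, i < S e u := by
  have hpart : Partrec fun m : ℕ => Nat.rfind fun u =>
      Part.some (decide (m.unpair.2 < S m.unpair.1 u)) := by
    refine Partrec.rfind (Computable.partrec ?_)
    fun_prop
  obtain ⟨code, hcode⟩ := Code.exists_code.1 (Partrec.nat_iff.1 hpart)
  refine ⟨code, fun e i => ?_⟩
  rw [hcode]
  refine Nat.rfind_dom.trans ?_
  simp

theorem exists_eq_of_unit_steps {S : ℕ → ℕ} (hS0 : S 0 = 0) (hS : ∀ u, S (u + 1) ≤ S u + 1)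
    {t u : ℕ} (h : t ≤ S u) : ∃ v, S v = t := by
  induction u with
  | zero => exact ⟨0, by omega⟩
  | succ u ih =>
    by_cases h' : t ≤ S u
    · exact ih h'
    · exact ⟨u + 1, by have := hS u; omega⟩

/-- The number of moves observed by stage `u`: a move is observed when the current outputs
exhibit the counters after the previously observed moves. -/
def observed (a b : ℕ) (o₁ o₂ : ℕ → ℕ → Option ℕ) (u : ℕ) : ℕ :=
  Nat.rec 0 (fun u t => bif exhibits a b (o₁ u) (o₂ u) t then t + 1 else t) u

theorem computable_observed {a b : ℕ → ℕ} (ha : Computable a) (hb : Computable b)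
    {o₁ o₂ : ℕ → ℕ → Option ℕ} (ho₁ : Computable fun p : ℕ × ℕ => o₁ p.1 p.2)
    (ho₂ : Computable fun p : ℕ × ℕ => o₂ p.1 p.2) :
    Computable fun p : ℕ × ℕ => observed (a p.1) (b p.1) o₁ o₂ p.2 := by
  have hex : Computable fun p : (ℕ × ℕ) × ℕ × ℕ =>
      exhibits (a p.1.1) (b p.1.1) (o₁ p.2.1) (o₂ p.2.1) p.2.2 := by
    unfold exhibits
    refine Computable.decide_eq (Computable.sum_range (by fun_prop) ?_) (by fun_prop)
    fun_prop
  exact Computable.fun_nat_rec (α := ℕ × ℕ) (f := fun p => p.2) (g := fun _ => 0)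
    (h := fun p u t => bif exhibits (a p.1) (b p.1) (o₁ u) (o₂ u) t then t + 1 else t)
    (by fun_prop) (by fun_prop) (by fun_prop)

theorem observed_succ (a b : ℕ) (o₁ o₂ : ℕ → ℕ → Option ℕ) (u : ℕ) :
    observed a b o₁ o₂ (u + 1) = observed a b o₁ o₂ u ∧
        ¬ Exhibits a b (o₁ u) (o₂ u) (observed a b o₁ o₂ u) ∨
      Exhibits a b (o₁ u) (o₂ u) (observed a b o₁ o₂ u) ∧
        observed a b o₁ o₂ (u + 1) = observed a b o₁ o₂ u + 1 := by
  rw [← exhibits_iff]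
  have hrec : observed a b o₁ o₂ (u + 1) =
      bif exhibits a b (o₁ u) (o₂ u) (observed a b o₁ o₂ u)
        then observed a b o₁ o₂ u + 1 else observed a b o₁ o₂ u := rfl
  rw [hrec]
  cases exhibits a b (o₁ u) (o₂ u) (observed a b o₁ o₂ u) <;> simp

/-- If the number `t` of granted moves matches the number of observed ones, the opponent cannot
exhibit the final values of the counters. -/
theorem not_eventually_exhibits {a b : ℕ} {K : ℕ → ℕ} {g : ℕ → ℝ} (hg : Monotone g)
    (hg0 : 0 ≤ g 0) (hg1 : ∀ u, g u < 1) {o₁ o₂ : ℕ → ℕ → Option ℕ}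
    (ho₁ : ∀ u u' n, ⌊g u * 2 ^ K n⌋₊ = ⌊g u' * 2 ^ K n⌋₊ →
      ∀ v ∈ o₁ u n, ∀ v' ∈ o₁ u' n, v = v')
    (ho₂ : ∀ u u' n, ⌊g u * 2 ^ K n⌋₊ = ⌊g u' * 2 ^ K n⌋₊ →
      ∀ v ∈ o₂ u n, ∀ v' ∈ o₂ u' n, v = v')
    (hsum : 1 ≤ ∑ i ∈ Finset.range (b - a), (2 : ℝ) ^ i / 2 ^ K (a + 1 + i)) {t : ℕ}
    (htT : t ≤ 2 * (2 ^ (b - a) - 1))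
    (ht : ∀ i < 2 * (2 ^ (b - a) - 1), (∃ u, i < observed a b o₁ o₂ u) ↔ i < t) :
    ¬ ∀ᶠ u in atTop, Exhibits a b (o₁ u) (o₂ u) t := by
  intro hev
  set S := observed a b o₁ o₂
  have hS : ∀ u, S (u + 1) = S u ∧ ¬ Exhibits a b (o₁ u) (o₂ u) (S u) ∨
      Exhibits a b (o₁ u) (o₂ u) (S u) ∧ S (u + 1) = S u + 1 := observed_succ a b o₁ o₂
  have hSmono : Monotone S :=
    monotone_nat_of_le_succ fun u => by rcases hS u with h | h <;> omega
  obtain ⟨u, hu⟩ : ∃ u, S u = t := by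
    rcases Nat.eq_zero_or_pos t with rfl | hpos
    · exact ⟨0, rfl⟩
    · obtain ⟨u, hu⟩ := (ht (t - 1) (by omega)).2 (by omega)
      exact exists_eq_of_unit_steps (S := S) rfl (fun u => by rcases hS u with h | h <;> omega)
        (u := u) (by omega)
  rcases htT.lt_or_eq with hlt | heq
  · obtain ⟨u', hR, huu'⟩ := (hev.and (eventually_ge_atTop u)).exists
    have hbd : ∀ v, S v ≤ t := by
      intro v
      by_contra! hv
      exact lt_irrefl t ((ht t hlt).1 ⟨v, hv⟩)
    have h1 : S u' = t := le_antisymm (hbd u') (hu ▸ hSmono huu')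
    rcases hS u' with h | h
    · exact h.2 (h1.symm ▸ hR)
    · have := hbd (u' + 1)
      have : S (u' + 1) = S u' + 1 := h.2
      omega
  · refine not_exhibits_all_moves hg hg0 hg1 ho₁ ho₂ hsum (S := S) rfl
      (fun u => (hS u).imp_left And.left) (hu.trans heq) ?_
    rw [hu]
    exact hev

end Construction

/-- if h(n) − n is nondecreasing and Σ_n 2^{n−h(n)} = ∞, then there are
two left-c.e. reals such that no left-c.e. real computes both with oracle-use h + c. -/
theorem stmt_16 (h : ℕ → ℕ) (hcomp : Computable h)
    (hmono : Monotone fun n : ℕ => (h n : ℤ) - (n : ℤ))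
    (hdiv : ¬ Summable fun n : ℕ => (2 : ℝ) ^ ((n : ℤ) - (h n : ℤ))) :
    ∃ α β : ℝ, α ∈ Set.Ioo (0:ℝ) 1 ∧ β ∈ Set.Ioo (0:ℝ) 1 ∧ LeftCE α ∧ LeftCE β ∧
      ∀ γ : ℝ, γ ∈ Set.Icc (0:ℝ) 1 → LeftCE γ → ∀ c : ℕ,
        ¬ (ComputableFromWithUse α γ (fun n => h n + c) ∧
           ComputableFromWithUse β γ (fun n => h n + c)) := by
  obtain ⟨d, hd⟩ : ∃ d : ℕ → ℕ, ∀ n, h n = n + d n := by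
    refine ⟨fun n => h n - n, fun n => ?_⟩
    have := hmono (Nat.zero_le n)
    dsimp only at this ⊢
    omega
  have hdcomp : Computable d := by
    have h1 : Computable fun n => h n - n := by fun_prop
    exact h1.of_eq fun n => by rw [hd]; omega
  have hdmono : Monotone d := by
    intro m n hmn
    have := hmono hmn
    simp only [hd] at this
    omega
  have hddiv : ¬ Summable fun n => 1 / (2 : ℝ) ^ d n := by
    refine fun hs => hdiv (hs.congr fun n => ?_)
    rw [hd, show (n : ℤ) - ((n + d n : ℕ) : ℤ) = -(d n : ℤ) by push_cast; ring, zpow_neg,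
      zpow_natCast, one_div]
  obtain ⟨a, b, ha, hb, ha0, hab, hsucc, hsum⟩ := exists_blocks hdcomp hdmono hddiv
  set T : ℕ → ℕ := fun e => 2 * (2 ^ (b e - a e) - 1) with hT
  have hTcomp : Computable T := by fun_prop
  have hcount := computable_countMoves hTcomp
  have hpow : ∀ e, 0 < 2 ^ (b e - a e) := fun e => by positivity
  obtain ⟨α, hα, hαce, hαdig⟩ := exists_leftCE_of_counters ha hb ha0 hab hsucc
    (x := fun e s => (countMoves (T e) e s + 1) / 2) (by fun_prop)
    (fun e s s' hs => Nat.div_le_div_right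
      (Nat.add_le_add_right (monotone_countMoves (T e) e hs) 1))
    (fun e s => by
      have h1 : countMoves (T e) e s ≤ 2 * (2 ^ (b e - a e) - 1) := countMoves_le _ e s
      have h2 := hpow e
      omega)
  obtain ⟨β, hβ, hβce, hβdig⟩ := exists_leftCE_of_counters ha hb ha0 hab hsucc
    (x := fun e s => countMoves (T e) e s / 2) (by fun_prop)
    (fun e s s' hs => Nat.div_le_div_right (monotone_countMoves (T e) e hs))
    (fun e s => by
      have h1 : countMoves (T e) e s ≤ 2 * (2 ^ (b e - a e) - 1) := countMoves_le _ e s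
      have h2 := hpow e
      omega)
  refine ⟨α, β, hα, hβ, hαce, hβce, ?_⟩
  rintro γ hγ hγce c ⟨⟨Φ, hΦ, hΦα⟩, Ψ, hΨ, hΨβ⟩
  obtain ⟨N, D, hN, hD, hNDmono, hND1, hND⟩ := exists_fraction_approx hγ hγce
  have hk : Computable fun n => h n + c := by fun_prop
  obtain ⟨o₁, ho₁comp, ho₁, ho₁α⟩ := exists_output_approx hΦ hN hD hk hα hND hΦα
  obtain ⟨o₂, ho₂comp, ho₂, ho₂β⟩ := exists_output_approx hΨ hN hD hk hβ hND hΨβ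
  obtain ⟨code, hcode⟩ := exists_code_halts_iff
    (S := fun e => observed (a e) (b e) o₁ o₂) (computable_observed ha hb ho₁comp ho₂comp)
  obtain ⟨e, he₁, he₂⟩ : ∃ e : ℕ, e.unpair.1 = c ∧
      Denumerable.ofNat Nat.Partrec.Code e.unpair.2 = code :=
    ⟨Nat.pair c (Encodable.encode code), by simp, by simp⟩
  obtain ⟨t, htT, ht, htev⟩ := exists_eventually_countMoves
    (P := fun i => ∃ u, i < observed (a e) (b e) o₁ o₂ u)
    (fun i j hij ⟨u, hu⟩ => ⟨u, hij.trans_lt hu⟩) (e := e) (by rw [he₂]; exact hcode e) (T e)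
  refine not_eventually_exhibits hNDmono (by positivity) hND1 ho₁ ho₂ ?_ htT ht ?_
  · refine (hsum e).trans_eq (Finset.sum_congr rfl fun i _ => ?_)
    rw [hd, he₁]
  · have hout : ∀ᶠ u in Filter.atTop, ∀ i ∈ Finset.range (b e - a e),
        ⌊α * 2 ^ (a e + 1 + i)⌋₊ ∈ o₁ u (a e + 1 + i) ∧
          ⌊β * 2 ^ (a e + 1 + i)⌋₊ ∈ o₂ u (a e + 1 + i) :=
      (Filter.eventually_all_finset _).2 fun i _ => (ho₁α _).and (ho₂β _)
    filter_upwards [hout] with u hu i hi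
    obtain ⟨h1, h2⟩ := hu i (Finset.mem_range.2 hi)
    have hi' : a e + 1 + i - a e = i + 1 := by omega
    refine ⟨⟨_, h1, ?_⟩, _, h2, ?_⟩
    · rw [← hi']
      exact hαdig e _ (htev.mono fun s hs => by rw [hs]) _ (by omega) (by omega)
    · rw [← hi']
      exact hβdig e _ (htev.mono fun s hs => by rw [hs]) _ (by omega) (by omega)
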